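/- Let λ_1, …, λ_d > 0 and b ∈ ℝ^d, and define F on the simplex Δ_{d−1} = {y ∈ ℝ^d : yᵢ ≥ 0, Σᵢ yᵢ = 1} by F(y) = − Σ_{i=1}^d √(yᵢ)·|bᵢ| − √(Σ_{i=1}^d λᵢ^{−1} yᵢ). For y ∈ Δ_{d−1} let u(y) ∈ ℝ^d have coordinates uᵢ = √(yᵢ)·sign(bᵢ). Then ‖u(y)‖_2 = 1 and −F(y) = u(y)ᵀ b + ‖u(y)‖_{Λ^{−1}} where Λ = diag(λ); consequently, for every ε > 0, y is an ε-minimizer of F over Δ_{d−1} if and only if u(y) is an ε-maximizer of u ↦ uᵀb + ‖u‖_{Λ^{−1}} over the Euclidean unit ball {u : ‖u‖_2 ≤ 1}. -/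

import Mathlib

open Matrix Set

/-- `mNorm M z = √(zᵀ M z)`. -/
noncomputable def mNorm {d : ℕ} (M : Matrix (Fin d) (Fin d) ℝ) (z : Fin d → ℝ) : ℝ :=
  Real.sqrt (z ⬝ᵥ M *ᵥ z)

/-- Euclidean norm of a vector in `ℝ^d`. -/
noncomputable def e2 {d : ℕ} (z : Fin d → ℝ) : ℝ :=
  Real.sqrt (∑ i, z i ^ 2)

/-- The simplex `Δ_{d-1} = {y : yᵢ ≥ 0, Σᵢ yᵢ = 1}`. -/
def stdSimplex' (d : ℕ) : Set (Fin d → ℝ) :=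
  {y | (∀ i, 0 ≤ y i) ∧ ∑ i, y i = 1}

/-- The objective `F(y) = -Σᵢ √(yᵢ)|bᵢ| - √(Σᵢ λᵢ⁻¹ yᵢ)` of problem `P_C`. -/
noncomputable def Fobj {d : ℕ} (lam b : Fin d → ℝ) (y : Fin d → ℝ) : ℝ :=
  -∑ i, Real.sqrt (y i) * |b i| - Real.sqrt (∑ i, (lam i)⁻¹ * y i)

/-- The map `y ↦ u(y)` with `uᵢ = √(yᵢ)·sign(bᵢ)`, where `sign(a) = 1` if `a ≥ 0`
and `-1` otherwise. -/
noncomputable def uOf {d : ℕ} (b y : Fin d → ℝ) : Fin d → ℝ :=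
  fun i => Real.sqrt (y i) * (if 0 ≤ b i then (1 : ℝ) else -1)

/-- The objective `G(u) = uᵀb + ‖u‖_{Λ⁻¹}` of problem `P_X` for a centered
unit-ball action set. -/
noncomputable def Gobj {d : ℕ} (lam b : Fin d → ℝ) (u : Fin d → ℝ) : ℝ :=
  u ⬝ᵥ b + mNorm (Matrix.diagonal lam)⁻¹ u

theorem mNorm_diagonal_inv {d : ℕ} {lam : Fin d → ℝ} (hpos : ∀ i, 0 < lam i) (u : Fin d → ℝ) :
    mNorm (Matrix.diagonal lam)⁻¹ u = Real.sqrt (∑ i, (lam i)⁻¹ * u i ^ 2) := by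
  have hinv : (Matrix.diagonal lam)⁻¹ = Matrix.diagonal fun i => (lam i)⁻¹ := by
    apply Matrix.inv_eq_right_inv
    rw [Matrix.diagonal_mul_diagonal, ← Matrix.diagonal_one]
    congr 1
    funext i
    exact mul_inv_cancel₀ (hpos i).ne'
  unfold mNorm
  rw [hinv]
  congr 1
  simp only [dotProduct, Matrix.mulVec_diagonal]
  exact Finset.sum_congr rfl fun i _ => by ring

theorem uOf_sq {d : ℕ} (b : Fin d → ℝ) {y : Fin d → ℝ} {i : Fin d} (hy : 0 ≤ y i) :
    uOf b y i ^ 2 = y i := by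
  unfold uOf
  rw [mul_pow, Real.sq_sqrt hy]
  split_ifs <;> norm_num

theorem uOf_mul {d : ℕ} (b y : Fin d → ℝ) (i : Fin d) :
    uOf b y i * b i = Real.sqrt (y i) * |b i| := by
  unfold uOf
  split_ifs with h
  · rw [abs_of_nonneg h, mul_one]
  · rw [abs_of_neg (not_le.mp h)]
    ring

theorem e2_uOf {d : ℕ} (b : Fin d → ℝ) {y : Fin d → ℝ} (hy : y ∈ stdSimplex' d) :
    e2 (uOf b y) = 1 := by
  unfold e2
  rw [Finset.sum_congr rfl fun i _ => uOf_sq b (hy.1 i), hy.2, Real.sqrt_one]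

theorem neg_Fobj_eq_Gobj_uOf {d : ℕ} {lam : Fin d → ℝ} (hpos : ∀ i, 0 < lam i)
    (b : Fin d → ℝ) {y : Fin d → ℝ} (hy : y ∈ stdSimplex' d) :
    -(Fobj lam b y) = Gobj lam b (uOf b y) := by
  unfold Fobj Gobj
  rw [mNorm_diagonal_inv hpos, dotProduct, Finset.sum_congr rfl fun i _ => uOf_mul b y i,
    Finset.sum_congr rfl fun i _ => congrArg ((lam i)⁻¹ * ·) (uOf_sq b (hy.1 i))]
  ring

/-- Every point of the unit ball is dominated by a point of the simplex: the missing mass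
`1 - ‖u‖²` is distributed according to `y`. -/
theorem exists_Gobj_le_neg_Fobj {d : ℕ} {lam : Fin d → ℝ} (hpos : ∀ i, 0 < lam i)
    (b : Fin d → ℝ) {y : Fin d → ℝ} (hy : y ∈ stdSimplex' d) {u : Fin d → ℝ} (hu : e2 u ≤ 1) :
    ∃ z ∈ stdSimplex' d, Gobj lam b u ≤ -(Fobj lam b z) := by
  have hs : ∑ i, u i ^ 2 ≤ 1 := by
    simpa [e2, Real.sqrt_le_one] using hu
  have hle : ∀ i, u i ^ 2 ≤ u i ^ 2 + (1 - ∑ j, u j ^ 2) * y i := fun i =>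
    le_add_of_nonneg_right (mul_nonneg (sub_nonneg.mpr hs) (hy.1 i))
  refine ⟨fun i => u i ^ 2 + (1 - ∑ j, u j ^ 2) * y i,
    ⟨fun i => (sq_nonneg _).trans (hle i), ?_⟩, ?_⟩
  · rw [Finset.sum_add_distrib, ← Finset.mul_sum, hy.2]
    ring
  · unfold Gobj Fobj
    rw [mNorm_diagonal_inv hpos, neg_sub, sub_neg_eq_add, add_comm, dotProduct]
    refine add_le_add (Real.sqrt_le_sqrt (Finset.sum_le_sum fun i _ => ?_))
      (Finset.sum_le_sum fun i _ => ?_)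
    · exact mul_le_mul_of_nonneg_left (hle i) (inv_nonneg.mpr (hpos i).le)
    · calc u i * b i ≤ |u i| * |b i| := (le_abs_self _).trans (abs_mul _ _).le
        _ ≤ _ := mul_le_mul_of_nonneg_right (Real.abs_le_sqrt (hle i)) (abs_nonneg _)

theorem bddBelow_Fobj_image {d : ℕ} {lam : Fin d → ℝ} (hpos : ∀ i, 0 < lam i)
    (b : Fin d → ℝ) : BddBelow (Fobj lam b '' stdSimplex' d) := by
  refine ⟨-∑ i, |b i| - Real.sqrt (∑ i, (lam i)⁻¹), ?_⟩
  rintro _ ⟨y, hy, rfl⟩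
  have hle : ∀ i, y i ≤ 1 := fun i =>
    hy.2 ▸ Finset.single_le_sum (fun j _ => hy.1 j) (Finset.mem_univ i)
  refine sub_le_sub (neg_le_neg (Finset.sum_le_sum fun i _ => ?_))
    (Real.sqrt_le_sqrt (Finset.sum_le_sum fun i _ => ?_))
  · exact mul_le_of_le_one_left (abs_nonneg _) (Real.sqrt_le_one.mpr (hle i))
  · exact mul_le_of_le_one_right (inv_nonneg.mpr (hpos i).le) (hle i)

theorem sSup_Gobj_eq_neg_sInf_Fobj {d : ℕ} {lam : Fin d → ℝ} (hpos : ∀ i, 0 < lam i)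
    (b : Fin d → ℝ) (hne : (stdSimplex' d).Nonempty) :
    sSup (Gobj lam b '' {u : Fin d → ℝ | e2 u ≤ 1}) = -sInf (Fobj lam b '' stdSimplex' d) := by
  obtain ⟨y, hy⟩ := hne
  have hub : ∀ g ∈ Gobj lam b '' {u : Fin d → ℝ | e2 u ≤ 1},
      g ≤ -sInf (Fobj lam b '' stdSimplex' d) := by
    rintro _ ⟨u, hu, rfl⟩
    obtain ⟨z, hz, h⟩ := exists_Gobj_le_neg_Fobj hpos b hy hu
    exact h.trans (neg_le_neg (csInf_le (bddBelow_Fobj_image hpos b) (mem_image_of_mem _ hz)))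
  apply le_antisymm
  · exact csSup_le ⟨_, mem_image_of_mem _ (e2_uOf b hy).le⟩ hub
  · rw [neg_le]
    refine le_csInf ⟨_, mem_image_of_mem _ hy⟩ ?_
    rintro _ ⟨z, hz, rfl⟩
    rw [neg_le, neg_Fobj_eq_Gobj_uOf hpos b hz]
    exact le_csSup ⟨_, hub⟩ (mem_image_of_mem _ (e2_uOf b hz).le)

/-- for `y` in the simplex, `‖u(y)‖₂ = 1`,
`-F(y) = u(y)ᵀb + ‖u(y)‖_{Λ⁻¹}`, and `y` is an `ε`-minimizer of `F` over the
simplex iff `u(y)` is an `ε`-maximizer of `u ↦ uᵀb + ‖u‖_{Λ⁻¹}` over the Euclidean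
unit ball. -/
theorem stmt12 {d : ℕ} (lam : Fin d → ℝ) (hpos : ∀ i, 0 < lam i)
    (b : Fin d → ℝ) (ε : ℝ) (hε : 0 < ε)
    (y : Fin d → ℝ) (hy : y ∈ stdSimplex' d) :
    e2 (uOf b y) = 1 ∧
    -(Fobj lam b y) = Gobj lam b (uOf b y) ∧
    ((Fobj lam b y ≤ sInf (Fobj lam b '' stdSimplex' d) + ε) ↔
      (uOf b y ∈ {u : Fin d → ℝ | e2 u ≤ 1} ∧
        sSup (Gobj lam b '' {u : Fin d → ℝ | e2 u ≤ 1}) - ε ≤ Gobj lam b (uOf b y))) := by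
  have he := e2_uOf b hy
  have hG := neg_Fobj_eq_Gobj_uOf hpos b hy
  refine ⟨he, hG, ?_⟩
  rw [sSup_Gobj_eq_neg_sInf_Fobj hpos b ⟨y, hy⟩, ← hG]
  constructor
  · exact fun h => ⟨he.le, by linarith⟩
  · rintro ⟨-, h⟩
    linarith
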